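/- Let P be a finite bounded ranked poset of rank n (all maximal chains from 0̂ to 1̂ saturated with unit rank increments). Then the monomial order ideal SFY of P is pure: every maximal monomial under divisibility of SFY has degree exactly ⌊(n-1)/2⌋. -/

import Mathlib

/-- The rank gap along a chain (with predecessor of the first element being `⊥`, of rank 0). -/
def gap {P : Type} [PartialOrder P] (ρ : P → ℕ) {s : ℕ} (f : Fin s → P) (i : Fin s) : ℕ :=
  ρ (f i) - (if (i : ℕ) = 0 then 0
    else ρ (f ⟨(i : ℕ) - 1, lt_of_le_of_lt (Nat.sub_le _ _) i.2⟩))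

/-- The degree of a monomial. -/
def mdeg {σ : Type} (m : σ →₀ ℕ) : ℕ := m.sum fun _ e => e

/-- `m` is an SFY monomial for the bounded weakly ranked poset `P`. -/
def IsSFY {P : Type} [PartialOrder P] [BoundedOrder P] (ρ : P → ℕ) (m : P →₀ ℕ) : Prop :=
  ∃ (s : ℕ) (f : Fin s → P) (ℓ : Fin s → ℕ),
    (∀ i j : Fin s, i < j → f i < f j) ∧ (∀ i, (⊥ : P) < f i) ∧ (∀ i, f i < (⊤ : P)) ∧
    (∀ i, 1 ≤ ℓ i) ∧ (∀ i, ℓ i < gap ρ f i) ∧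
    (∀ k : Fin s, (ℓ k : ℤ) + 2 * ∑ i ∈ Finset.univ.filter (fun j => k < j), (ℓ i : ℤ)
        ≤ (ρ ⊤ : ℤ) - (ρ (f k) : ℤ)) ∧
    m = ∑ i, Finsupp.single (f i) (ℓ i)

section RankFunction

variable {P : Type} [Fintype P] [PartialOrder P]

theorem rank_strictMono {ρ : P → ℕ} (hcov : ∀ x y : P, x ⋖ y → ρ y = ρ x + 1) :
    StrictMono ρ := by
  classical
  let := Fintype.toLocallyFiniteOrder (α := P)
  rw [strictMono_iff_forall_covBy]
  intro x y h
  have := hcov x y h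
  omega

theorem exists_mem_Icc_rank_eq {ρ : P → ℕ} (hcov : ∀ x y : P, x ⋖ y → ρ y = ρ x + 1)
    {x y : P} (hxy : x ≤ y) {k : ℕ} (hx : ρ x ≤ k) (hy : k ≤ ρ y) :
    ∃ r ∈ Set.Icc x y, ρ r = k := by
  induction k, hx using Nat.le_induction with
  | base => exact ⟨x, ⟨le_rfl, hxy⟩, rfl⟩
  | succ k _ ih =>
    obtain ⟨r, ⟨hxr, hry⟩, hr⟩ := ih (by omega)
    have hlt : r < y := lt_of_le_of_ne hry (by rintro rfl; omega)
    obtain ⟨z, hrz, hzy⟩ := hlt.exists_covby_le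
    exact ⟨z, ⟨hxr.trans (hrz.lt.le), hzy⟩, by rw [hcov r z hrz, hr]⟩

end RankFunction

theorem mdeg_eq_sum {P : Type} [Fintype P] (m : P →₀ ℕ) : mdeg m = ∑ p, m p :=
  Finsupp.sum_fintype _ _ fun _ => rfl

section Intrinsic

variable {P : Type} [Fintype P] [PartialOrder P]

open Classical in
/-- The total exponent of `m` strictly above `p`. -/
noncomputable def degAbove (m : P →₀ ℕ) (p : P) : ℕ := ∑ u with p < u, m u

open Classical in
theorem degAbove_add_single (m : P →₀ ℕ) (r t : P) :
    degAbove (m + Finsupp.single r 1 : P →₀ ℕ) t = degAbove m t + if t < r then 1 else 0 := by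
  simp [degAbove, Finset.sum_add_distrib, Finset.sum_filter, Finsupp.single_apply]

/-- Splitting off the contribution of the successor `p` of `q` in the support of `m`. -/
theorem degAbove_eq_add_of_succ {m : P →₀ ℕ} {p q : P} (hqp : q < p)
    (h : ∀ t, m t ≠ 0 → q < t → p ≤ t) :
    degAbove m q = m p + degAbove m p := by
  classical
  unfold degAbove
  rw [← Finset.sum_insert (by simp)]
  refine (Finset.sum_subset ?_ fun x hx hx' => ?_).symm
  · intro x hx
    rcases Finset.mem_insert.mp hx with rfl | hx
    · simpa using hqp
    · simpa using hqp.trans (by simpa using hx)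
  · by_contra hne
    refine hx' ?_
    rcases (h x hne (by simpa using hx)).eq_or_lt with rfl | hlt
    · simp
    · simp [hlt]

variable [BoundedOrder P]

/-- A description of SFY monomials without reference to an enumeration of the support. -/
structure IsSFYMonomial (ρ : P → ℕ) (m : P →₀ ℕ) : Prop where
  chain : ∀ p q, m p ≠ 0 → m q ≠ 0 → p ≤ q ∨ q ≤ p
  bot : m ⊥ = 0
  top : m ⊤ = 0
  gap : ∀ p q, m p ≠ 0 → (q = ⊥ ∨ m q ≠ 0) → q < p → ρ q + m p < ρ p
  above : ∀ p, m p ≠ 0 → ρ p + m p + 2 * degAbove m p ≤ ρ ⊤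

theorem IsSFY.isSFYMonomial {ρ : P → ℕ} (hρ : StrictMono ρ) (hbot : ρ ⊥ = 0) {m : P →₀ ℕ}
    (hm : IsSFY ρ m) : IsSFYMonomial ρ m := by
  classical
  obtain ⟨s, f, l, hf, hfb, hft, hl, hgap, htop, rfl⟩ := hm
  have hmono : StrictMono f := fun i j h => hf i j h
  have hval : ∀ i, (∑ i, Finsupp.single (f i) (l i)) (f i) = l i := by
    intro i
    rw [Finsupp.finsetSum_apply, Finset.sum_eq_single i]
    · simp
    · intro j _ hj
      exact Finsupp.single_eq_of_ne (fun h => hj (hmono.injective h).symm)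
    · simp
  have hrange : ∀ p, (∑ i, Finsupp.single (f i) (l i)) p ≠ 0 → ∃ i, f i = p := by
    intro p hp
    by_contra! h
    refine hp ?_
    rw [Finsupp.finsetSum_apply]
    exact Finset.sum_eq_zero fun i _ => Finsupp.single_eq_of_ne (h i).symm
  refine ⟨?_, ?_, ?_, ?_, ?_⟩
  · intro p q hp hq
    obtain ⟨i, rfl⟩ := hrange p hp
    obtain ⟨j, rfl⟩ := hrange q hq
    exact (le_total i j).imp (fun h => hmono.monotone h) (fun h => hmono.monotone h)
  · by_contra h
    obtain ⟨i, hi⟩ := hrange _ h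
    exact (hfb i).ne' hi
  · by_contra h
    obtain ⟨i, hi⟩ := hrange _ h
    exact (hft i).ne hi
  · intro p q hp hq hqp
    obtain ⟨i, rfl⟩ := hrange p hp
    rw [hval]
    have hg := hgap i
    unfold _root_.gap at hg
    rcases hq with rfl | hq
    · omega
    · obtain ⟨j, rfl⟩ := hrange q hq
      have hji : j < i := hmono.lt_iff_lt.mp hqp
      have hji' : (j : ℕ) < i := hji
      rw [if_neg (by omega)] at hg
      have hle : ρ (f j) ≤ ρ (f ⟨(i : ℕ) - 1, lt_of_le_of_lt (Nat.sub_le _ _) i.2⟩) :=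
        hρ.monotone (hmono.monotone (Fin.le_def.mpr (by simp only; omega)))
      omega
  · intro p hp
    obtain ⟨k, rfl⟩ := hrange p hp
    have hsum : degAbove (∑ i, Finsupp.single (f i) (l i)) (f k)
        = ∑ i ∈ Finset.univ.filter (fun j => k < j), l i := by
      unfold degAbove
      simp only [Finsupp.finsetSum_apply]
      rw [Finset.sum_comm, Finset.sum_filter]
      refine Finset.sum_congr rfl fun i _ => ?_
      simp [Finsupp.single_apply, hmono.lt_iff_lt]
    have := htop k
    rw [hval, hsum]
    zify
    linarith

theorem IsSFYMonomial.isSFY {ρ : P → ℕ} (hbot : ρ ⊥ = 0) {m : P →₀ ℕ}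
    (hm : IsSFYMonomial ρ m) : IsSFY ρ m := by
  classical
  let : LinearOrder m.support :=
    { (inferInstance : PartialOrder m.support) with
      le_total := fun a b => hm.chain a b (Finsupp.mem_support_iff.mp a.2)
        (Finsupp.mem_support_iff.mp b.2)
      toDecidableLE := Classical.decRel _ }
  let e := Fintype.orderIsoFinOfCardEq m.support (Fintype.card_coe m.support)
  have hmne : ∀ i, m (e i) ≠ 0 := fun i => Finsupp.mem_support_iff.mp (e i).2
  have hlt : ∀ i j, ((e i : P) < e j) ↔ i < j := fun i j => e.lt_iff_lt
  refine ⟨_, fun i => e i, fun i => m (e i), fun i j h => (hlt i j).mpr h,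
    ?_, ?_, ?_, ?_, ?_, ?_⟩ <;> dsimp only [_root_.gap]
  · exact fun i => bot_lt_iff_ne_bot.mpr fun h => hmne i (by rw [h, hm.bot])
  · exact fun i => lt_top_iff_ne_top.mpr fun h => hmne i (by rw [h, hm.top])
  · exact fun i => Nat.one_le_iff_ne_zero.mpr (hmne i)
  · intro i
    have hb : (⊥ : P) < e i := bot_lt_iff_ne_bot.mpr fun h => hmne i (by rw [h, hm.bot])
    split_ifs with h
    · have := hm.gap (e i) ⊥ (hmne i) (Or.inl rfl) hb
      omega
    · have := hm.gap (e i) (e ⟨(i : ℕ) - 1, lt_of_le_of_lt (Nat.sub_le _ _) i.2⟩) (hmne i)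
        (Or.inr (hmne _)) ((hlt _ _).mpr (Fin.lt_def.mpr (by simp only; omega)))
      omega
  · intro k
    have hsum : degAbove m (e k) = ∑ i ∈ Finset.univ.filter (fun j => k < j), m (e i) := by
      unfold degAbove
      simp only [Finset.sum_filter, ← hlt]
      refine Eq.trans ?_
        (e.toEquiv.sum_comp (fun x : m.support => if (e k : P) < x then m x else 0)).symm
      rw [Finset.sum_coe_sort m.support (fun x => if (e k : P) < x then m x else 0)]
      refine (Finset.sum_subset (Finset.subset_univ _) fun x _ hx => ?_).symm
      simp [Finsupp.notMem_support_iff.mp hx]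
    have := hm.above (e k) (hmne k)
    rw [hsum] at this
    zify at this
    linarith
  · refine Eq.trans ?_
      (e.toEquiv.sum_comp (fun x : m.support => Finsupp.single (x : P) (m x))).symm
    rw [Finset.sum_coe_sort m.support (fun x => Finsupp.single x (m x))]
    exact m.sum_single.symm

theorem IsSFYMonomial.degAbove_bot {ρ : P → ℕ} {m : P →₀ ℕ} (hm : IsSFYMonomial ρ m) :
    degAbove m ⊥ = mdeg m := by
  classical
  rw [mdeg_eq_sum]
  refine Finset.sum_subset (Finset.subset_univ _) fun x _ hx => ?_
  have : x = ⊥ := by simpa [bot_lt_iff_ne_bot] using hx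
  rw [this, hm.bot]

theorem IsSFYMonomial.add_single {ρ : P → ℕ} {m : P →₀ ℕ} (hm : IsSFYMonomial ρ m) {r : P}
    (hr : r ≠ ⊥) (hr' : r ≠ ⊤) (hchain : ∀ t, m t ≠ 0 → t ≤ r ∨ r ≤ t)
    (hgap : ∀ q, (q = ⊥ ∨ m q ≠ 0) → q < r → ρ q + m r + 1 < ρ r)
    (hgap' : ∀ t, m t ≠ 0 → r < t → ρ r + m t < ρ t)
    (habove : ρ r + m r + 1 + 2 * degAbove m r ≤ ρ ⊤)
    (hbelow : ∀ t, m t ≠ 0 → t < r → ρ t + m t + 2 * degAbove m t + 2 ≤ ρ ⊤) :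
    IsSFYMonomial ρ (m + Finsupp.single r 1) := by
  classical
  have hself : (m + Finsupp.single r 1 : P →₀ ℕ) r = m r + 1 := by simp
  have hother : ∀ t, t ≠ r → (m + Finsupp.single r 1 : P →₀ ℕ) t = m t := by
    intro t ht
    simp [Finsupp.single_eq_of_ne ht]
  refine ⟨?_, ?_, ?_, ?_, ?_⟩
  · intro p q hp hq
    rcases eq_or_ne p r with rfl | hpr
    · rcases eq_or_ne q p with rfl | hqr
      · exact Or.inl le_rfl
      · exact (hchain q (by rwa [hother q hqr] at hq)).symm
    · rw [hother p hpr] at hp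
      rcases eq_or_ne q r with rfl | hqr
      · exact hchain p hp
      · exact hm.chain p q hp (by rwa [hother q hqr] at hq)
  · rw [hother _ hr.symm, hm.bot]
  · rw [hother _ hr'.symm, hm.top]
  · intro p q hp hq hqp
    rcases eq_or_ne p r with rfl | hpr
    · rw [hother q hqp.ne] at hq
      rw [hself]
      exact hgap q hq hqp
    · rw [hother p hpr] at hp ⊢
      rcases eq_or_ne q r with rfl | hqr
      · exact hgap' p hp hqp
      · rw [hother q hqr] at hq
        exact hm.gap p q hp hq hqp
  · intro p hp
    rw [degAbove_add_single]
    rcases eq_or_ne p r with rfl | hpr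
    · rw [hself, if_neg (lt_irrefl p)]
      omega
    · rw [hother p hpr] at hp ⊢
      split_ifs with h
      · have := hbelow p hp h
        omega
      · exact hm.above p hp

theorem IsSFYMonomial.two_mul_mdeg_le {ρ : P → ℕ} (hbot : ρ ⊥ = 0) {m : P →₀ ℕ}
    (hm : IsSFYMonomial ρ m) : 2 * mdeg m ≤ ρ ⊤ - 1 := by
  rcases m.support.eq_empty_or_nonempty with h | h
  · rw [Finsupp.support_eq_empty.mp h]
    simp [mdeg]
  · obtain ⟨p, hp⟩ := m.support.exists_minimal h
    have hp0 : m p ≠ 0 := Finsupp.mem_support_iff.mp hp.prop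
    have hpb : ⊥ < p := bot_lt_iff_ne_bot.mpr fun h => hp0 (h ▸ hm.bot)
    have hdeg : mdeg m = m p + degAbove m p := by
      rw [← hm.degAbove_bot]
      refine degAbove_eq_add_of_succ hpb fun t ht _ => ?_
      exact (hm.chain p t hp0 ht).elim id
        fun h => hp.le_of_le (Finsupp.mem_support_iff.mpr ht) h
    have h1 := hm.gap p ⊥ hp0 (Or.inl rfl) hpb
    have h2 := hm.above p hp0
    omega

/-- An SFY monomial of less than the maximal possible degree can be multiplied by a variable. -/
theorem IsSFYMonomial.exists_add_single {ρ : P → ℕ}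
    (hcov : ∀ x y : P, x ⋖ y → ρ y = ρ x + 1) (hbot : ρ ⊥ = 0) {m : P →₀ ℕ}
    (hm : IsSFYMonomial ρ m) (hdeg : 2 * mdeg m + 3 ≤ ρ ⊤) :
    ∃ r, IsSFYMonomial ρ (m + Finsupp.single r 1) := by
  classical
  have hρ := rank_strictMono hcov
  have htop_above : degAbove m ⊤ = 0 := by simp [degAbove]
  obtain ⟨p, hp⟩ := (Finset.univ.filter fun p : P => (p = ⊤ ∨ m p ≠ 0) ∧
    ρ ⊤ ≤ ρ p + m p + 2 * degAbove m p + 1).exists_minimal ⟨⊤, by simp; omega⟩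
  obtain ⟨hpS, hpb⟩ : (p = ⊤ ∨ m p ≠ 0) ∧ ρ ⊤ ≤ ρ p + m p + 2 * degAbove m p + 1 := by
    simpa using hp.prop
  have hbelow : ∀ t, m t ≠ 0 → t < p → ρ t + m t + 2 * degAbove m t + 2 ≤ ρ ⊤ := by
    intro t ht htp
    by_contra! h
    exact htp.not_ge (hp.le_of_le (by simp [ht]; omega) htp.le)
  have hbp : ⊥ < p := by
    rw [bot_lt_iff_ne_bot]
    rintro rfl
    rcases hpS with h | h
    · rw [← h] at hdeg
      omega
    · exact h hm.bot
  obtain ⟨q, hq⟩ := (Finset.univ.filter fun q : P => (q = ⊥ ∨ m q ≠ 0) ∧ q < p).exists_maximal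
    ⟨⊥, by simp [hbp]⟩
  obtain ⟨hqS, hqp⟩ : (q = ⊥ ∨ m q ≠ 0) ∧ q < p := by simpa using hq.prop
  have hq_max : ∀ t, (t = ⊥ ∨ m t ≠ 0) → t < p → t ≤ q := by
    intro t ht htp
    have hcomp : t ≤ q ∨ q ≤ t := by
      rcases ht with rfl | ht
      · exact Or.inl bot_le
      · rcases hqS with rfl | hq0
        · exact Or.inr bot_le
        · exact hm.chain t q ht hq0
    exact hcomp.elim id fun h => hq.le_of_ge (by simp [ht, htp]) h
  have hp_comp : ∀ t, m t ≠ 0 → t < p ∨ p ≤ t := by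
    intro t ht
    have : t ≤ p ∨ p ≤ t := by
      rcases hpS with rfl | hp0
      · exact Or.inl le_top
      · exact hm.chain t p ht hp0
    rcases this with h | h
    · exact h.lt_or_eq.imp id fun h => h.ge
    · exact Or.inr h
  have hsucc : ∀ t, m t ≠ 0 → q < t → p ≤ t := fun t ht hqt =>
    (hp_comp t ht).resolve_left fun h => hqt.not_ge (hq_max t (Or.inr ht) h)
  have hsplit := degAbove_eq_add_of_succ hqp hsucc
  have hq3 : ρ q + 2 * degAbove m q + 3 ≤ ρ ⊤ := by
    rcases hqS with rfl | hq0
    · rw [hm.degAbove_bot, hbot]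
      omega
    · have := hbelow q hq0 hqp
      omega
  by_cases hroom : ρ q + m p + 3 ≤ ρ p
  · obtain ⟨r, ⟨hqr, hrp⟩, hr⟩ :=
      exists_mem_Icc_rank_eq hcov hqp.le (k := ρ q + 2) (by omega) (by omega)
    replace hqr : q < r := lt_of_le_of_ne hqr (by rintro rfl; omega)
    replace hrp : r < p := lt_of_le_of_ne hrp (by rintro rfl; omega)
    have hmr : m r = 0 := by
      by_contra h
      exact hrp.not_ge (hsucc r h hqr)
    have hr_above : degAbove m r = m p + degAbove m p :=
      degAbove_eq_add_of_succ hrp fun t ht h => hsucc t ht (hqr.trans h)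
    refine ⟨r, hm.add_single (bot_le.trans_lt hqr).ne' (hrp.trans_le le_top).ne ?_ ?_ ?_ ?_ ?_⟩
    · exact fun t ht => (hp_comp t ht).imp (fun h => (hq_max t (Or.inr ht) h).trans hqr.le)
        (fun h => hrp.le.trans h)
    · intro t ht htr
      have := hρ.monotone (hq_max t ht (htr.trans hrp))
      omega
    · intro t ht hrt
      rcases (hsucc t ht (hqr.trans hrt)).eq_or_lt with rfl | hpt
      · omega
      · have hp0 : m p ≠ 0 := hpS.resolve_left fun h => (h ▸ hpt).not_ge le_top
        have := hm.gap t p ht (Or.inr hp0) hpt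
        have := hρ hrp
        omega
    · omega
    · exact fun t ht htr => hbelow t ht (htr.trans hrp)
  · have hp0 : m p ≠ 0 := by
      refine hpS.resolve_left ?_
      rintro rfl
      rw [hm.top] at hroom
      omega
    refine ⟨p, hm.add_single hbp.ne' (fun h => hp0 (h ▸ hm.top))
      (fun t ht => hm.chain t p ht hp0) ?_ ?_ ?_ hbelow⟩
    · intro t ht htp
      have := hρ.monotone (hq_max t ht htp)
      omega
    · exact fun t ht hpt => hm.gap t p ht (Or.inr hp0) hpt
    · omega

end Intrinsic

/-- For a finite bounded ranked poset `P` of rank `n`, the monomial order ideal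
`SFY` is pure: every maximal monomial under divisibility has degree exactly `⌊(n-1)/2⌋`. -/
theorem stmt8 {P : Type} [Fintype P] [PartialOrder P] [BoundedOrder P]
    (n : ℕ) (ρ : P → ℕ)
    (hcov : ∀ x y : P, x ⋖ y → ρ y = ρ x + 1)
    (hbot : ρ ⊥ = 0) (htop : ρ ⊤ = n)
    (m : P →₀ ℕ) (hm : IsSFY ρ m)
    (hmax : ∀ m' : P →₀ ℕ, IsSFY ρ m' → m ≤ m' → m' = m) :
    mdeg m = (n - 1) / 2 := by
  subst htop
  have hm' := hm.isSFYMonomial (rank_strictMono hcov) hbot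
  have hle := hm'.two_mul_mdeg_le hbot
  by_contra hne
  obtain ⟨r, hr⟩ := hm'.exists_add_single hcov hbot (by omega)
  have h := DFunLike.congr_fun (hmax _ (hr.isSFY hbot) le_self_add) r
  simp at h
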